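/- Let (S,Σ) be a measurable space, M > 0, X : S → [0,M] measurable, Q and P probability measures on (S,Σ), with Lebesgue decomposition P = P_ac + P_s with respect to Q, A ∈ Σ such that Q(S∖A) = P_s(A) = 0, and h = dP_ac/dQ. Let u : ℝ → ℝ be increasing and v : ℝ → ℝ measurable, and let K := { Y ∈ 𝓘 : E_Q[v(W₀^Ins − (1+ρ)Y + Π₀)] ≥ v(W₀^Ins) }. If Y₁* ∈ K maximizes ∫_A u(W₀ − X + Y − Π₀)·h dQ over Y ∈ K, then Y* := Y₁*·1_A + X·1_{S∖A} belongs to K and maximizes E_P[u(W₀ − X + Y − Π₀)] over Y ∈ K. In particular, full insurance Y = X on the singular set S∖A is optimal, since ∫_{S∖A} u(W₀ − X + Y − Π₀) dP_s ≤ u(W₀ − Π₀)·P_s(S∖A) for every Y ∈ 𝓘 with equality at Y = X on S∖A. -/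

import Mathlib

open MeasureTheory

/-- A monotone function of a measurable random variable with values in a bounded interval is
integrable with respect to a finite measure. -/
theorem Monotone.integrable_comp_of_mem_Icc {S : Type*} [MeasurableSpace S] {μ : Measure S}
    [IsFiniteMeasure μ] {u : ℝ → ℝ} (hu : Monotone u) {f : S → ℝ} (hf : Measurable f) {a b : ℝ}
    (hab : ∀ s, f s ∈ Set.Icc a b) : Integrable (fun s => u (f s)) μ :=
  Integrable.of_mem_Icc (u a) (u b) (hu.measurable.comp hf).aemeasurable
    (ae_of_all _ fun s => ⟨hu (hab s).1, hu (hab s).2⟩)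

/-- Splitting of an integral with respect to the sum of a measure with density `h` with respect
to `Q` and a singular measure `ν`, along a set `A` carrying `Q` and null for `ν`. -/
theorem integral_withDensity_add_eq_setIntegral_add {S : Type*} [MeasurableSpace S]
    {Q ν : Measure S} {A : Set S} (hQA : Q Aᶜ = 0) (hνA : ν A = 0)
    {h : S → ℝ} (hhm : Measurable h) (hh0 : ∀ s, 0 ≤ h s) {f : S → ℝ}
    (hf : Integrable f (Q.withDensity fun s => ENNReal.ofReal (h s))) (hfν : Integrable f ν) :
    ∫ s, f s ∂(Q.withDensity (fun s => ENNReal.ofReal (h s)) + ν)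
      = (∫ s in A, f s * h s ∂Q) + ∫ s in Aᶜ, f s ∂ν := by
  have hQ : Q.restrict A = Q := Measure.restrict_eq_self_of_ae_mem (mem_ae_iff.mpr hQA)
  have hν : ν.restrict Aᶜ = ν :=
    Measure.restrict_eq_self_of_ae_mem (mem_ae_iff.mpr (by rwa [compl_compl] : ν Aᶜᶜ = 0))
  rw [integral_add_measure hf hfν, hQ, hν,
    integral_withDensity_eq_integral_toReal_smul hhm.ennreal_ofReal
      (ae_of_all _ fun _ => ENNReal.ofReal_lt_top)]
  simp [ENNReal.toReal_ofReal (hh0 _), mul_comm]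

/-- The splitting lemma behind Theorems 3.1 and 3.2: with `P = P_ac + P_s` the Lebesgue
decomposition of `P` w.r.t. `Q`, `A` carrying `Q` with `P_s(A) = 0` and `h = dP_ac/dQ`,
if `Y₁* ∈ K` maximizes `∫_A u(W₀−X+Y−π₀)·h dQ` over the feasible set
`K = {Y ∈ 𝓘 : E_Q[v(W₀Ins−(1+ρ)Y+π₀)] ≥ v(W₀Ins)}`, then
`Y* = Y₁*·1_A + X·1_{S∖A}` belongs to `K` and maximizes `E_P[u(W₀−X+Y−π₀)]` over `K`.
In particular full insurance is optimal on the singular set: for every `Y ∈ 𝓘`,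
`∫_{S∖A} u(W₀−X+Y−π₀) dP_s ≤ u(W₀−π₀)·P_s(S∖A)`, with equality at `Y = X`. -/
theorem splitting_singular_part {S : Type*} [MeasurableSpace S]
    (M : ℝ) (hM : 0 < M)
    (X : S → ℝ) (hXm : Measurable X) (hX : ∀ s, X s ∈ Set.Icc (0:ℝ) M)
    (Q P Pac Ps : Measure S) [IsProbabilityMeasure Q] [IsProbabilityMeasure P]
    (hdec : P = Pac + Ps) (hac : Pac ≪ Q)
    (A : Set S) (hAm : MeasurableSet A) (hQA : Q Aᶜ = 0) (hPsA : Ps A = 0)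
    (h : S → ℝ) (hhm : Measurable h) (hh0 : ∀ s, 0 ≤ h s)
    (hhd : Pac = Q.withDensity fun s => ENNReal.ofReal (h s))
    (W₀ W₀Ins π₀ ρ : ℝ) (hπ : 0 < π₀) (hρ : 0 ≤ ρ)
    (u : ℝ → ℝ) (hu : Monotone u) (v : ℝ → ℝ) (hvm : Measurable v)
    (K : Set (S → ℝ))
    (hK : K = {Y : S → ℝ | Measurable Y ∧ (∀ s, 0 ≤ Y s ∧ Y s ≤ X s) ∧
      v W₀Ins ≤ ∫ s, v (W₀Ins - (1 + ρ) * Y s + π₀) ∂Q})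
    (Y₁ : S → ℝ) (hY₁ : Y₁ ∈ K)
    (hY₁opt : ∀ Y ∈ K,
      (∫ s in A, u (W₀ - X s + Y s - π₀) * h s ∂Q)
        ≤ ∫ s in A, u (W₀ - X s + Y₁ s - π₀) * h s ∂Q) :
    (fun s => A.indicator Y₁ s + Aᶜ.indicator X s) ∈ K ∧
    (∀ Y ∈ K, (∫ s, u (W₀ - X s + Y s - π₀) ∂P)
      ≤ ∫ s, u (W₀ - X s + (A.indicator Y₁ s + Aᶜ.indicator X s) - π₀) ∂P) ∧
    (∀ Y : S → ℝ, Measurable Y → (∀ s, 0 ≤ Y s ∧ Y s ≤ X s) →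
      (∫ s in Aᶜ, u (W₀ - X s + Y s - π₀) ∂Ps) ≤ u (W₀ - π₀) * (Ps Aᶜ).toReal) ∧
    (∫ s in Aᶜ, u (W₀ - X s + X s - π₀) ∂Ps) = u (W₀ - π₀) * (Ps Aᶜ).toReal := by
  subst hK
  obtain ⟨hY₁m, hY₁b, hY₁v⟩ := hY₁
  have hPac : Pac ≤ P := hdec ▸ Measure.le_add_right le_rfl
  have hPs : Ps ≤ P := hdec ▸ Measure.le_add_left le_rfl
  have : IsFiniteMeasure Pac := isFiniteMeasure_of_le P hPac
  have : IsFiniteMeasure Ps := isFiniteMeasure_of_le P hPs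
  have hint : ∀ μ : Measure S, IsFiniteMeasure μ → ∀ Y : S → ℝ, Measurable Y →
      (∀ s, 0 ≤ Y s ∧ Y s ≤ X s) → Integrable (fun s => u (W₀ - X s + Y s - π₀)) μ := by
    intro μ _ Y hYm hYb
    refine hu.integrable_comp_of_mem_Icc (a := W₀ - M - π₀) (b := W₀ - π₀) (by fun_prop) ?_
    intro s
    have := hYb s
    have := (hX s).2
    constructor <;> linarith
  have hsing : ∀ Y : S → ℝ, Measurable Y → (∀ s, 0 ≤ Y s ∧ Y s ≤ X s) →
      (∫ s in Aᶜ, u (W₀ - X s + Y s - π₀) ∂Ps) ≤ u (W₀ - π₀) * (Ps Aᶜ).toReal := by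
    intro Y hYm hYb
    calc (∫ s in Aᶜ, u (W₀ - X s + Y s - π₀) ∂Ps) ≤ ∫ _ in Aᶜ, u (W₀ - π₀) ∂Ps := by
          refine integral_mono (hint _ inferInstance Y hYm hYb) (integrable_const _) fun s => hu ?_
          linarith [(hYb s).2]
      _ = u (W₀ - π₀) * (Ps Aᶜ).toReal := by simp [Measure.real, mul_comm]
  have hfull : (∫ s in Aᶜ, u (W₀ - X s + X s - π₀) ∂Ps) = u (W₀ - π₀) * (Ps Aᶜ).toReal := by
    simp [Measure.real, mul_comm]
  set Z : S → ℝ := fun s => A.indicator Y₁ s + Aᶜ.indicator X s with hZ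
  have hZA : ∀ s ∈ A, Z s = Y₁ s := fun s hs => by simp [hZ, hs]
  have hZAc : ∀ s ∈ Aᶜ, Z s = X s := fun s hs => by
    have : s ∉ A := hs
    simp [hZ, this]
  have hZm : Measurable Z := (hY₁m.indicator hAm).add (hXm.indicator hAm.compl)
  have hZb : ∀ s, 0 ≤ Z s ∧ Z s ≤ X s := by
    intro s
    by_cases hs : s ∈ A
    · rw [hZA s hs]; exact hY₁b s
    · rw [hZAc s hs]; exact ⟨(hX s).1, le_rfl⟩
  refine ⟨⟨hZm, hZb, ?_⟩, ?_, hsing, hfull⟩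
  · refine hY₁v.trans_eq (integral_congr_ae ?_)
    filter_upwards [show ∀ᵐ s ∂Q, s ∈ A from mem_ae_iff.mpr hQA] with s hs
    rw [hZA s hs]
  · intro Y hY
    have hsplit : ∀ Y : S → ℝ, Measurable Y → (∀ s, 0 ≤ Y s ∧ Y s ≤ X s) →
        ∫ s, u (W₀ - X s + Y s - π₀) ∂P = (∫ s in A, u (W₀ - X s + Y s - π₀) * h s ∂Q)
          + ∫ s in Aᶜ, u (W₀ - X s + Y s - π₀) ∂Ps := by
      intro Y hYm hYb
      rw [hdec, hhd]
      exact integral_withDensity_add_eq_setIntegral_add hQA hPsA hhm hh0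
        (hhd ▸ hint Pac inferInstance Y hYm hYb) (hint Ps inferInstance Y hYm hYb)
    change _ ≤ ∫ s, u (W₀ - X s + Z s - π₀) ∂P
    rw [hsplit Y hY.1 hY.2.1, hsplit Z hZm hZb]
    have hZ₁ : (∫ s in A, u (W₀ - X s + Z s - π₀) * h s ∂Q)
        = ∫ s in A, u (W₀ - X s + Y₁ s - π₀) * h s ∂Q :=
      setIntegral_congr_fun hAm fun s hs => by simp only [hZA s hs]
    have hZ₂ : (∫ s in Aᶜ, u (W₀ - X s + Z s - π₀) ∂Ps)
        = ∫ s in Aᶜ, u (W₀ - X s + X s - π₀) ∂Ps :=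
      setIntegral_congr_fun hAm.compl fun s hs => by simp only [hZAc s hs]
    rw [hZ₁, hZ₂, hfull]
    exact add_le_add (hY₁opt Y hY) (hsing Y hY.1 hY.2.1)
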